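/- Let R be a commutative ring, M a GV-torsion-free R-module, and (L, ι) a w-envelope of M. Then M is weak w-projective if and only if L is weak w-projective. -/

import Mathlib

/-!  Background definitions for the `w`-operation theory of Wang–Kim–Qiao.  -/

open CategoryTheory

section WTheory

variable (R : Type) [CommRing R]

/-- `J` is a Glaz–Vasconcelos ideal: it is finitely generated and the natural map
`R → Hom_R(J, R)`, sending `r` to multiplication by `r`, is bijective. -/
def IsGVIdeal (J : Ideal R) : Prop :=
  J.FG ∧ Function.Bijective fun r : R => (r • J.subtype : J →ₗ[R] R)

/-- `M` is `GV`-torsion: every element is annihilated by some GV-ideal. -/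
def IsGVTorsion (M : Type*) [AddCommGroup M] [Module R M] : Prop :=
  ∀ x : M, ∃ J : Ideal R, IsGVIdeal R J ∧ ∀ j ∈ J, j • x = 0

/-- `M` is `GV`-torsion-free: no nonzero element is annihilated by a GV-ideal. -/
def IsGVTorsionFree (M : Type*) [AddCommGroup M] [Module R M] : Prop :=
  ∀ x : M, (∃ J : Ideal R, IsGVIdeal R J ∧ ∀ j ∈ J, j • x = 0) → x = 0

/-- `Ext^n_R(M, N)`, as an `R`-module. -/
noncomputable def extM (M N : Type) [AddCommGroup M] [Module R M]
    [AddCommGroup N] [Module R N] (n : ℕ) : ModuleCat R :=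
  ((Ext R (ModuleCat R) n).obj (Opposite.op (ModuleCat.of R M))).obj (ModuleCat.of R N)

/-- `M` is a `w`-module: it is GV-torsion-free and `Ext^1_R(R/J, M) = 0`
for every GV-ideal `J`. -/
def IsWModule (M : Type) [AddCommGroup M] [Module R M] : Prop :=
  IsGVTorsionFree R M ∧
    ∀ J : Ideal R, IsGVIdeal R J → Subsingleton (extM R (R ⧸ J) M 1)

/-- `(L, ι)` is a `w`-envelope of `M`: `L` is a `w`-module, `ι : M → L` is an injective
linear map, and its cokernel is GV-torsion. -/
def IsWEnvelope (M L : Type) [AddCommGroup M] [Module R M] [AddCommGroup L]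
    [Module R L] (ι : M →ₗ[R] L) : Prop :=
  IsWModule R L ∧ Function.Injective ι ∧ IsGVTorsion R (L ⧸ LinearMap.range ι)

/-- The GV-torsion submodule `tor_GV(M)`.  (The displayed generating set is already closed
under the module operations, since the GV-ideals form a multiplicative system of ideals,
so the span coincides with the displayed set.) -/
def torGV (M : Type) [AddCommGroup M] [Module R M] : Submodule R M :=
  Submodule.span R {x : M | ∃ J : Ideal R, IsGVIdeal R J ∧ ∀ j ∈ J, j • x = 0}

/-- `M` is `w`-projective: for every GV-torsion-free `w`-module `N` and every
`w`-envelope `(L, ι)` of `M / tor_GV(M)`, the module `Ext^1_R(L, N)` is GV-torsion. -/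
def IsWProjective (M : Type) [AddCommGroup M] [Module R M] : Prop :=
  ∀ (N : Type) [AddCommGroup N] [Module R N], IsGVTorsionFree R N → IsWModule R N →
    ∀ (L : Type) [AddCommGroup L] [Module R L] (ι : (M ⧸ torGV R M) →ₗ[R] L),
      IsWEnvelope R (M ⧸ torGV R M) L ι → IsGVTorsion R (extM R L N 1)

/-- `N` belongs to the class `P_w^{†∞}`: it is GV-torsion-free and
`Ext^k_R(M, N) = 0` for every `w`-projective `M` and every `k ≥ 1`. -/
def MemPwDaggerInfty (N : Type) [AddCommGroup N] [Module R N] : Prop :=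
  IsGVTorsionFree R N ∧
    ∀ (M : Type) [AddCommGroup M] [Module R M], IsWProjective R M →
      ∀ k : ℕ, 1 ≤ k → Subsingleton (extM R M N k)

/-- `M` is weak `w`-projective: `Ext^1_R(M, N) = 0` for every `N ∈ P_w^{†∞}`. -/
def IsWeakWProjective (M : Type) [AddCommGroup M] [Module R M] : Prop :=
  ∀ (N : Type) [AddCommGroup N] [Module R N], MemPwDaggerInfty R N →
    Subsingleton (extM R M N 1)

end WTheory

/-- Vanishing of `Ext^(n+1)` defined through derived functors agrees with vanishing of
`Abelian.Ext` defined through the derived category. -/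
theorem subsingleton_extM_succ_iff (R : Type) [CommRing R] (M N : Type) [AddCommGroup M]
    [Module R M] [AddCommGroup N] [Module R N] (n : ℕ) :
    Subsingleton (extM R M N (n + 1)) ↔
      Subsingleton (Abelian.Ext.{0} (ModuleCat.of R M) (ModuleCat.of R N) (n + 1)) := by
  have P := ProjectiveResolution.of (ModuleCat.of R M)
  have hExt : Subsingleton (extM R M N (n + 1)) ↔
      ∀ f : P.complex.X (n + 1) ⟶ ModuleCat.of R N, P.complex.d (n + 2) (n + 1) ≫ f = 0 →
        ∃ g : P.complex.X n ⟶ ModuleCat.of R N, P.complex.d (n + 1) n ≫ g = f := by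
    rw [← ModuleCat.isZero_iff_subsingleton, extM, (P.isoExt (n + 1) (ModuleCat.of R N)).isZero_iff,
      ← HomologicalComplex.exactAt_iff_isZero_homology,
      HomologicalComplex.exactAt_iff' _ n (n + 1) (n + 2) (by simp) (by simp),
      ShortComplex.moduleCat_exact_iff]
    rfl
  rw [hExt]
  constructor
  · refine fun h => subsingleton_of_forall_eq 0 fun α => ?_
    obtain ⟨f, hf, rfl⟩ := P.extMk_surjective α (n + 2) rfl
    exact (P.extMk_eq_zero_iff f (n + 2) rfl hf n rfl).2 (h f hf)
  · exact fun h f hf =>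
      (P.extMk_eq_zero_iff f (n + 2) rfl hf n rfl).1 (Subsingleton.elim _ _)

/-- The `w`-envelope of the zero module is zero. -/
theorem IsWEnvelope.subsingleton {R : Type} [CommRing R] {M L : Type} [AddCommGroup M]
    [Module R M] [AddCommGroup L] [Module R L] {ι : M →ₗ[R] L} [Subsingleton M]
    (h : IsWEnvelope R M L ι) : Subsingleton L := by
  refine subsingleton_of_forall_eq 0 fun x => h.1.1 x ?_
  obtain ⟨J, hJ, hx⟩ := h.2.2 (Submodule.Quotient.mk x)
  refine ⟨J, hJ, fun j hj => ?_⟩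
  obtain ⟨m, hm⟩ := (Submodule.Quotient.mk_eq_zero _).1
    ((Submodule.Quotient.mk_smul _ j x).trans (hx j hj))
  rw [← hm, Subsingleton.elim m 0, map_zero]

theorem IsGVTorsion.torGV_eq_top {R : Type} [CommRing R] {T : Type} [AddCommGroup T]
    [Module R T] (hT : IsGVTorsion R T) : torGV R T = ⊤ :=
  eq_top_iff.2 fun x _ => Submodule.subset_span (hT x)

theorem IsGVTorsion.isWProjective {R : Type} [CommRing R] {T : Type} [AddCommGroup T]
    [Module R T] (hT : IsGVTorsion R T) : IsWProjective R T := by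
  intro N _ _ _ _ L _ _ ι hL x
  have : Subsingleton (T ⧸ torGV R T) :=
    Submodule.Quotient.subsingleton_iff.2 hT.torGV_eq_top
  have : Subsingleton L := hL.subsingleton
  have : Projective (ModuleCat.of R L) := (ModuleCat.isZero_of_subsingleton _).projective
  have : Subsingleton (extM R L N 1) :=
    ModuleCat.subsingleton_of_isZero (isZero_Ext_succ_of_projective _ _ 0)
  obtain ⟨J, hJ, -⟩ := hL.2.2 0
  exact ⟨J, hJ, fun _ _ => Subsingleton.elim _ _⟩

/-- If `ι : M → L` is injective and `Ext^1` and `Ext^2` of its cokernel into `N` vanish, then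
`Ext^1_R(M, N)` vanishes if and only if `Ext^1_R(L, N)` does. -/
theorem subsingleton_extM_one_iff_of_injective {R : Type} [CommRing R] {M L : Type}
    (N : Type) [AddCommGroup M] [Module R M] [AddCommGroup L] [Module R L] [AddCommGroup N]
    [Module R N] (ι : M →ₗ[R] L) (hι : Function.Injective ι)
    (h₁ : Subsingleton (extM R (L ⧸ LinearMap.range ι) N 1))
    (h₂ : Subsingleton (extM R (L ⧸ LinearMap.range ι) N 2)) :
    Subsingleton (extM R M N 1) ↔ Subsingleton (extM R L N 1) := by
  rw [subsingleton_extM_succ_iff] at h₁ h₂ ⊢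
  rw [subsingleton_extM_succ_iff]
  let S : ShortComplex (ModuleCat R) :=
    ShortComplex.mk (ModuleCat.ofHom ι) (ModuleCat.ofHom (LinearMap.range ι).mkQ)
      (by ext x; simp)
  have hS : S.ShortExact := ModuleCat.shortComplex_shortExact S
    (LinearMap.exact_iff.2 (Submodule.ker_mkQ _)) hι (Submodule.mkQ_surjective _)
  constructor
  · refine fun h => subsingleton_of_forall_eq 0 fun x => ?_
    obtain ⟨y, rfl⟩ := Abelian.Ext.contravariant_sequence_exact₂ hS _ x
      (h.elim _ _)
    rw [h₁.elim y 0, Abelian.Ext.comp_zero]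
  · refine fun h => subsingleton_of_forall_eq 0 fun x => ?_
    obtain ⟨y, rfl⟩ := Abelian.Ext.contravariant_sequence_exact₁ hS _ x
      (n₁ := 2) rfl (h₂.elim _ _)
    rw [h.elim y 0, Abelian.Ext.comp_zero]

/-- if `M` is GV-torsion-free and `(L, ι)` is a `w`-envelope of `M`,
then `M` is weak `w`-projective iff `L` is weak `w`-projective. -/
theorem weakWProjective_iff_wEnvelope (R : Type) [CommRing R]
    (M L : Type) [AddCommGroup M] [Module R M] [AddCommGroup L] [Module R L]
    (ι : M →ₗ[R] L) (hM : IsGVTorsionFree R M) (h : IsWEnvelope R M L ι) :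
    IsWeakWProjective R M ↔ IsWeakWProjective R L := by
  have key (N : Type) [AddCommGroup N] [Module R N] (hN : MemPwDaggerInfty R N) :
      Subsingleton (extM R M N 1) ↔ Subsingleton (extM R L N 1) :=
    subsingleton_extM_one_iff_of_injective N ι h.2.1
      (hN.2 _ h.2.2.isWProjective 1 le_rfl) (hN.2 _ h.2.2.isWProjective 2 one_le_two)
  exact ⟨fun hw N _ _ hN => (key N hN).1 (hw N hN), fun hw N _ _ hN => (key N hN).2 (hw N hN)⟩
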